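/- Let T be the truncated Fourier–Plancherel operator on L²(ℝ⁺), and let U be a surjective linear isometry from L²(ℝ⁺) onto the space L²(ℝ⁺; ℂ²) of square-integrable ℂ²-valued functions on (0,∞) such that, for every x ∈ L²(ℝ⁺) with ∫₀^∞ |x(ξ)|·ξ^{-1/2} dξ < ∞, one has (U x)(μ) = ((2π)^{-1/2} ∫₀^∞ x(ξ)·ξ^{-1/2}·ξ^{iμ} dξ, (2π)^{-1/2} ∫₀^∞ x(ξ)·ξ^{-1/2}·ξ^{-iμ} dξ) for almost every μ > 0. Then for every x ∈ L²(ℝ⁺), (U (T x))(μ) = F(μ)·(U x)(μ) for almost every μ > 0, where F(μ) acts on ℂ² by matrix multiplication. In other words, T = U⁻¹ ∘ M_F ∘ U where M_F is the operator of multiplication by the matrix function F. -/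

import Mathlib

open MeasureTheory Set

/-- Lebesgue measure restricted to `(0,∞)`. -/
noncomputable def m0 : Measure ℝ := volume.restrict (Ioi (0:ℝ))

/-- `F₊₋(μ) = (2π)^{-1/2} e^{iπ/4} e^{-πμ/2} Γ(1/2 + iμ)`. -/
noncomputable def Fpm (μ : ℝ) : ℂ :=
  (Real.sqrt (2 * Real.pi) : ℂ)⁻¹ * Complex.exp (Complex.I * Real.pi / 4) *
    Complex.exp (-(Real.pi * μ) / 2) * Complex.Gamma (1/2 + Complex.I * μ)

/-- `F₋₊(μ) = (2π)^{-1/2} e^{iπ/4} e^{πμ/2} Γ(1/2 - iμ)`. -/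
noncomputable def Fmp (μ : ℝ) : ℂ :=
  (Real.sqrt (2 * Real.pi) : ℂ)⁻¹ * Complex.exp (Complex.I * Real.pi / 4) *
    Complex.exp ((Real.pi * μ) / 2) * Complex.Gamma (1/2 - Complex.I * μ)

/-- The matrix `F(μ) = !![0, F₊₋(μ); F₋₊(μ), 0]`. -/
noncomputable def Fmat (μ : ℝ) : Matrix (Fin 2) (Fin 2) ℂ := !![0, Fpm μ; Fmp μ, 0]

section FmHelpers
open Filter Topology

lemma fm_gamma_int {a : ℂ} {b : ℝ} (ha : 0 < a.re) (hb : 0 < b) :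
    IntegrableOn (fun t : ℝ => t ^ (a.re - 1) * Real.exp (-b * t)) (Ioi 0) := by
  have := integrableOn_rpow_mul_exp_neg_mul_rpow (s := a.re - 1) (p := 1) (by linarith) zero_lt_one hb
  simpa using this

lemma fm_cpow_meas (a : ℂ) : Measurable (fun t : ℝ => (t : ℂ) ^ a) := by
  fun_prop

lemma fm_gamma_int' {a r : ℂ} (ha : 0 < a.re) (hr : 0 < r.re) :
    IntegrableOn (fun t : ℝ => (t : ℂ) ^ (a - 1) * Complex.exp (-(r * t))) (Ioi 0) := by
  refine Integrable.mono' (fm_gamma_int ha hr) ?_ ?_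
  · exact ((fm_cpow_meas _).mul (by fun_prop)).aestronglyMeasurable
  · filter_upwards [ae_restrict_mem measurableSet_Ioi] with t ht
    rw [norm_mul, Complex.norm_cpow_eq_rpow_re_of_pos ht, Complex.norm_exp]
    simp

lemma fm_gamma_diff {a r : ℂ} (ha : 0 < a.re) (hr : 0 < r.re) :
    DifferentiableAt ℂ (fun r : ℂ => ∫ t : ℝ in Ioi 0, (t : ℂ) ^ (a - 1) * Complex.exp (-(r * t))) r := by
  have hε : 0 < r.re / 2 := by linarith
  have ha1 : 0 < (a + 1).re := by simp; linarith
  refine (hasDerivAt_integral_of_dominated_loc_of_deriv_le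
    (F := fun (r : ℂ) (t : ℝ) => (t : ℂ) ^ (a - 1) * Complex.exp (-(r * t)))
    (F' := fun (r : ℂ) (t : ℝ) => (t : ℂ) ^ (a - 1) * (Complex.exp (-(r * t)) * (-t)))
    (bound := fun t : ℝ => t ^ ((a+1).re - 1) * Real.exp (-(r.re/2) * t))
    (Metric.ball_mem_nhds r hε) ?_ (fm_gamma_int' ha hr) ?_ ?_ (fm_gamma_int ha1 hε) ?_).2.differentiableAt
  · exact Eventually.of_forall fun r => ((fm_cpow_meas _).mul (by fun_prop)).aestronglyMeasurable
  · exact ((fm_cpow_meas _).mul (by fun_prop)).aestronglyMeasurable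
  · filter_upwards [ae_restrict_mem measurableSet_Ioi] with t ht z hz
    have ht' : 0 < t := ht
    have hz' : r.re / 2 ≤ z.re := by
      have h1 : |(z - r).re| ≤ ‖z - r‖ := Complex.abs_re_le_norm _
      rw [Metric.mem_ball, dist_eq_norm] at hz
      have := (abs_le.1 (h1.trans hz.le)).1
      simp at this; linarith
    rw [norm_mul, Complex.norm_cpow_eq_rpow_re_of_pos ht, norm_mul, Complex.norm_exp, norm_neg,
      Complex.norm_real, Real.norm_of_nonneg ht'.le]
    have e1 : t ^ ((a+1).re - 1) = t ^ ((a-1).re) * t := by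
      rw [← Real.rpow_add_one ht'.ne']; congr 1; simp
    rw [e1, mul_assoc, mul_comm (Real.exp _) t]
    gcongr
    simp
    nlinarith
  · filter_upwards with t z hz
    refine HasDerivAt.const_mul _ ?_
    refine HasDerivAt.cexp ?_
    have h := ((hasDerivAt_id z).mul_const (t : ℂ)).neg
    rw [one_mul] at h
    exact h

lemma fm_gamma_complex {a r : ℂ} (ha : 0 < a.re) (hr : 0 < r.re) :
    ∫ t : ℝ in Ioi 0, (t : ℂ) ^ (a - 1) * Complex.exp (-(r * t)) = (1 / r) ^ a * Complex.Gamma a := by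
  set S : Set ℂ := {z | 0 < z.re}
  have hS : IsOpen S := isOpen_lt continuous_const Complex.continuous_re
  have h1 : AnalyticOnNhd ℂ (fun r : ℂ => ∫ t : ℝ in Ioi 0, (t : ℂ) ^ (a - 1) * Complex.exp (-(r * t))) S :=
    DifferentiableOn.analyticOnNhd (fun z hz => (fm_gamma_diff ha hz).differentiableWithinAt) hS
  have h2 : AnalyticOnNhd ℂ (fun r : ℂ => (1 / r) ^ a * Complex.Gamma a) S := by
    refine DifferentiableOn.analyticOnNhd (fun z hz => ?_) hS
    have hz' : 0 < z.re := hz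
    have hz0 : z ≠ 0 := by rintro rfl; simp at hz'
    refine DifferentiableAt.differentiableWithinAt ?_
    refine DifferentiableAt.mul_const ?_ _
    refine DifferentiableAt.cpow (by fun_prop (disch := assumption)) (by fun_prop) ?_
    left
    rw [one_div, Complex.inv_re]
    exact div_pos hz' (Complex.normSq_pos.2 hz0)
  have hc : IsPreconnected S := (convex_halfSpace_re_gt 0).isPreconnected
  refine AnalyticOnNhd.eqOn_of_preconnected_of_frequently_eq h1 h2 hc (z₀ := ((1:ℝ) : ℂ)) (by simp [S]) ?_ hr
  have h_real : ∃ᶠ (x : ℝ) in 𝓝[≠] (1:ℝ), 0 < x :=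
    (eventually_nhdsWithin_of_eventually_nhds (lt_mem_nhds one_pos)).frequently
  have ht : Tendsto (fun x : ℝ => (x : ℂ)) (𝓝[≠] (1:ℝ)) (𝓝[≠] ((1:ℝ) : ℂ)) := by
    refine tendsto_nhdsWithin_of_tendsto_nhds_of_eventually_within _
      (Complex.continuous_ofReal.continuousAt.mono_left nhdsWithin_le_nhds) ?_
    filter_upwards [self_mem_nhdsWithin] with x hx
    simpa using hx
  refine ht.frequently (h_real.mono fun x hx => ?_)
  have := Complex.integral_cpow_mul_exp_neg_mul_Ioi ha hx
  simpa using this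

lemma fm_bound {s z : ℂ} (hs : s.re = 1/2) (hz : z ≠ 0) {ξ : ℝ} (hξ : 0 < ξ) (h : ‖z‖ ≤ 1 / ξ) :
    ‖z ^ s‖ ≤ ‖(ξ : ℂ) ^ (-s)‖ * Real.exp (Real.pi * |s.im|) := by
  rw [Complex.norm_cpow_of_ne_zero hz, Complex.norm_cpow_eq_rpow_re_of_pos hξ, div_eq_mul_inv, ← Real.exp_neg]
  have : ξ ^ (-s).re = (1 / ξ) ^ s.re := by
    rw [one_div, Real.inv_rpow hξ.le, ← Real.rpow_neg hξ.le]; simp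
  rw [this]
  gcongr
  · calc -(z.arg * s.im) ≤ |z.arg * s.im| := neg_le_abs _
      _ = |z.arg| * |s.im| := abs_mul _ _
      _ ≤ _ := by gcongr; exact Complex.abs_arg_le_pi z

lemma fm_rot {ξ : ℝ} (hξ : 0 < ξ) (s : ℂ) :
    (1 / (-(Complex.I * ξ))) ^ s = Complex.exp (Complex.I * Real.pi * s / 2) * (ξ : ℂ) ^ (-s) := by
  have hξ' : (ξ : ℂ) ≠ 0 := by exact_mod_cast hξ.ne'
  have h1 : (1 / (-(Complex.I * ξ))) = ((ξ⁻¹ : ℝ) : ℂ) * Complex.I := by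
    push_cast; field_simp; simp
  rw [h1, Complex.cpow_def_of_ne_zero (by simp [hξ']), Complex.cpow_def_of_ne_zero hξ',
    Complex.log_ofReal_mul (inv_pos.2 hξ) Complex.I_ne_zero, Complex.log_I, ← Complex.exp_add, Real.log_inv,
    ← Complex.ofReal_log hξ.le]
  congr 1; push_cast; ring

lemma fm_key (f : ℝ → ℂ) (s : ℂ) (hs : s.re = 1/2) (hf : IntegrableOn f (Ioi 0))
    (hf2 : IntegrableOn (fun ξ : ℝ => f ξ * (ξ:ℂ)^(-s)) (Ioi 0))
    (hg : IntegrableOn (fun t : ℝ => (∫ ξ : ℝ in Ioi 0, f ξ * Complex.exp (Complex.I * t * ξ)) * (t:ℂ)^(s-1)) (Ioi 0)) :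
    ∫ t : ℝ in Ioi 0, (∫ ξ : ℝ in Ioi 0, f ξ * Complex.exp (Complex.I * t * ξ)) * (t:ℂ)^(s-1)
     = Complex.Gamma s * Complex.exp (Complex.I * Real.pi * s / 2) * ∫ ξ : ℝ in Ioi 0, f ξ * (ξ:ℂ)^(-s) := by
  have hs0 : 0 < s.re := by rw [hs]; norm_num
  set ε : ℕ → ℝ := fun n => 1 / ((n : ℝ) + 1) with hεd
  have hε : ∀ n, 0 < ε n := fun n => by simp only [hεd]; positivity
  have hε0 : Tendsto ε atTop (𝓝 0) := tendsto_one_div_add_atTop_nhds_zero_nat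
  have hεc : Tendsto (fun n => (ε n : ℂ)) atTop (𝓝 0) := by
    have := (Complex.continuous_ofReal.tendsto 0).comp hε0
    rw [Complex.ofReal_zero] at this
    exact this
  -- left limit
  have l1 : Tendsto (fun n => ∫ t : ℝ in Ioi 0, ((∫ ξ : ℝ in Ioi 0, f ξ * Complex.exp (Complex.I * t * ξ)) * (t:ℂ)^(s-1)) * Complex.exp (-(ε n * t)))
      atTop (𝓝 (∫ t : ℝ in Ioi 0, (∫ ξ : ℝ in Ioi 0, f ξ * Complex.exp (Complex.I * t * ξ)) * (t:ℂ)^(s-1))) := by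
    refine tendsto_integral_of_dominated_convergence _ (fun n => hg.1.mul (by fun_prop)) hg.norm ?_ ?_
    · intro n
      filter_upwards [ae_restrict_mem measurableSet_Ioi] with t ht
      have ht' : 0 < t := ht
      rw [norm_mul]
      refine mul_le_of_le_one_right (norm_nonneg _) ?_
      rw [Complex.norm_exp]
      simp
      exact mul_nonneg (hε n).le ht'.le
    · filter_upwards with t
      have : Tendsto (fun n => Complex.exp (-(ε n * t))) atTop (𝓝 (Complex.exp (-(0 * t)))) :=
        (Complex.continuous_exp.tendsto _).comp ((hεc.mul_const _).neg)
      simpa using this.const_mul _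
  have l2 : Tendsto (fun n => ∫ ξ : ℝ in Ioi 0, f ξ * ((1 / (ε n - Complex.I * ξ)) ^ s * Complex.Gamma s)) atTop
      (𝓝 (∫ ξ : ℝ in Ioi 0, f ξ * ((1 / (-(Complex.I * ξ))) ^ s * Complex.Gamma s))) := by
    refine tendsto_integral_of_dominated_convergence
      (fun ξ => ‖f ξ * (ξ:ℂ)^(-s)‖ * (Real.exp (Real.pi * |s.im|) * ‖Complex.Gamma s‖)) (fun n => hf.1.mul ?_) (hf2.norm.mul_const _) ?_ ?_
    · refine Measurable.aestronglyMeasurable ?_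
      fun_prop
    · intro n
      filter_upwards [ae_restrict_mem measurableSet_Ioi] with ξ hξ
      have hξ' : 0 < ξ := hξ
      have hre : (ε n - Complex.I * ξ : ℂ).im = -ξ := by simp
      have hne : (ε n - Complex.I * ξ : ℂ) ≠ 0 := by
        intro h; rw [h] at hre; simp at hre; linarith
      have hn : ξ ≤ ‖(ε n - Complex.I * ξ : ℂ)‖ := by
        have := Complex.abs_im_le_norm (ε n - Complex.I * ξ : ℂ)
        rwa [hre, abs_neg, abs_of_pos hξ'] at this
      have := fm_bound hs (one_div_ne_zero hne) hξ' (by rw [norm_div, norm_one]; gcongr)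
      rw [norm_mul, norm_mul, norm_mul]
      calc _ ≤ ‖f ξ‖ * ((‖(ξ : ℂ) ^ (-s)‖ * Real.exp (Real.pi * |s.im|)) * ‖Complex.Gamma s‖) := by gcongr
        _ = _ := by ring
    · filter_upwards [ae_restrict_mem measurableSet_Ioi] with ξ hξ
      have hξ' : 0 < ξ := hξ
      have hξ'' : (ξ : ℂ) ≠ 0 := by exact_mod_cast hξ'.ne'
      refine Tendsto.const_mul _ (Tendsto.mul_const _ ?_)
      have h1 : (1 / (-(Complex.I * ξ))) = ((ξ⁻¹ : ℝ) : ℂ) * Complex.I := by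
        push_cast; field_simp; simp
      have hc : ContinuousAt (fun z : ℂ => z ^ s) (1 / (-(Complex.I * ξ))) := by
        refine continuousAt_cpow_const ?_
        right
        rw [h1]; simp [hξ'.ne']
      refine hc.tendsto.comp ?_
      refine Tendsto.div tendsto_const_nhds ?_ (by simp [hξ''])
      simpa using hεc.sub_const (Complex.I * ξ)
  have e : ∀ n, ∫ t : ℝ in Ioi 0, ((∫ ξ : ℝ in Ioi 0, f ξ * Complex.exp (Complex.I * t * ξ)) * (t:ℂ)^(s-1)) * Complex.exp (-(ε n * t))
      = ∫ ξ : ℝ in Ioi 0, f ξ * ((1 / (ε n - Complex.I * ξ)) ^ s * Complex.Gamma s) := by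
    intro n
    have hp : Integrable (fun p : ℝ × ℝ => ((p.1 : ℂ) ^ (s - 1) * Complex.exp (-((ε n : ℂ) * p.1))) * f p.2 * Complex.exp (Complex.I * p.1 * p.2)) ((volume.restrict (Ioi 0)).prod (volume.restrict (Ioi 0))) := by
      have h1 := fm_gamma_int' (a := s) (r := ε n) hs0 (by simpa using hε n)
      refine (Integrable.mul_prod h1 hf).mul_bdd (c := 1) (by fun_prop) ?_
      filter_upwards with p
      rw [Complex.norm_exp]; simp
    have := integral_integral_swap (f := fun t ξ : ℝ => ((t : ℂ) ^ (s - 1) * Complex.exp (-((ε n : ℂ) * t))) * f ξ * Complex.exp (Complex.I * t * ξ)) hp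
    calc _ = ∫ t : ℝ in Ioi 0, ∫ ξ : ℝ in Ioi 0, ((t : ℂ) ^ (s - 1) * Complex.exp (-((ε n : ℂ) * t))) * f ξ * Complex.exp (Complex.I * t * ξ) := by
          refine integral_congr_ae (Eventually.of_forall fun t => ?_)
          simp only [mul_assoc]
          rw [integral_const_mul, integral_const_mul]
          ring
      _ = _ := this
      _ = _ := by
          refine integral_congr_ae (Eventually.of_forall fun ξ => ?_)
          simp only
          rw [← fm_gamma_complex hs0 (r := ε n - Complex.I * ξ) (by simpa using hε n), ← integral_const_mul]
          refine integral_congr_ae (Eventually.of_forall fun t => ?_)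
          simp only
          have : Complex.exp (-((ε n - Complex.I * ξ) * t)) = Complex.exp (-((ε n : ℂ) * t)) * Complex.exp (Complex.I * t * ξ) := by
            rw [← Complex.exp_add]; congr 1; ring
          rw [this]; ring
  rw [tendsto_nhds_unique (l1.congr e) l2, ← integral_const_mul]
  refine setIntegral_congr_fun measurableSet_Ioi fun ξ hξ => ?_
  rw [fm_rot hξ]; ring

lemma fm_fourier_inj {μ : Measure ℝ} {h : ℝ → ℝ} (hh : Integrable h μ)
    (h0 : ∀ ω : ℝ, ∫ ξ, (h ξ : ℂ) * Complex.exp (ω * ξ * Complex.I) ∂μ = 0) : h =ᵐ[μ] 0 := by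
  have hm := hh.1.aemeasurable
  have hm' : AEMeasurable (fun ξ => -h ξ) μ := hm.neg
  have : IsFiniteMeasure (μ.withDensity fun ξ => ENNReal.ofReal (h ξ)) :=
    isFiniteMeasure_withDensity_ofReal hh.2
  have : IsFiniteMeasure (μ.withDensity fun ξ => ENNReal.ofReal (-h ξ)) :=
    isFiniteMeasure_withDensity_ofReal hh.neg.2
  have hb : ∀ (k : ℝ → ℝ) (ω : ℝ), Integrable k μ → Integrable (fun ξ => (k ξ : ℂ) * Complex.exp (ω * ξ * Complex.I)) μ := by
    intro k ω hk
    refine hk.ofReal.mul_bdd (c := 1) (by fun_prop) ?_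
    filter_upwards with ξ
    rw [Complex.norm_exp]; simp
  have heq : (μ.withDensity fun ξ => ENNReal.ofReal (h ξ)) = μ.withDensity fun ξ => ENNReal.ofReal (-h ξ) := by
    refine Measure.ext_of_charFun ?_
    ext ω
    rw [charFun_apply_real, charFun_apply_real,
      integral_withDensity_eq_integral_toReal_smul₀ hm.ennreal_ofReal (by simp),
      integral_withDensity_eq_integral_toReal_smul₀ hm'.ennreal_ofReal (by simp), ← sub_eq_zero]
    simp only [Complex.real_smul, ENNReal.toReal_ofReal']
    rw [← integral_sub (hb _ ω hh.pos_part) (hb (fun ξ => max (-h ξ) 0) ω hh.neg_part), ← h0 ω]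
    refine integral_congr_ae (Eventually.of_forall fun ξ => ?_)
    simp only
    rw [← sub_mul, ← Complex.ofReal_sub]
    congr 2
    rcases le_total 0 (h ξ) with h1 | h1 <;> simp [h1]
  have h2 := (withDensity_eq_iff hm.ennreal_ofReal hm'.ennreal_ofReal
    hh.lintegral_lt_top.ne).1 heq
  filter_upwards [h2] with ξ hξ
  rcases le_total 0 (h ξ) with h1 | h1
  · rw [ENNReal.ofReal_of_nonpos (p := -h ξ) (by linarith)] at hξ
    exact le_antisymm (ENNReal.ofReal_eq_zero.1 hξ) h1
  · rw [ENNReal.ofReal_of_nonpos h1] at hξ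
    have := ENNReal.ofReal_eq_zero.1 hξ.symm
    simp; linarith

lemma fm_fourier_injC {μ : Measure ℝ} {g : ℝ → ℂ} (hg : Integrable g μ)
    (h0 : ∀ ω : ℝ, ∫ ξ, g ξ * Complex.exp (ω * ξ * Complex.I) ∂μ = 0) : g =ᵐ[μ] 0 := by
  have hb : ∀ (k : ℝ → ℂ) (ω : ℝ), Integrable k μ → Integrable (fun ξ => k ξ * Complex.exp (ω * ξ * Complex.I)) μ := by
    intro k ω hk
    refine hk.mul_bdd (c := 1) (by fun_prop) ?_
    filter_upwards with ξ
    rw [Complex.norm_exp]; simp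
  have hgc : Integrable (fun ξ => (starRingEnd ℂ) (g ξ)) μ :=
    (LinearIsometryEquiv.integrable_comp_iff Complex.conjLIE).2 hg
  have h1 : ∀ ω : ℝ, ∫ ξ, (starRingEnd ℂ) (g ξ) * Complex.exp (ω * ξ * Complex.I) ∂μ = 0 := by
    intro ω
    have := congrArg (starRingEnd ℂ) (h0 (-ω))
    rw [← integral_conj, map_zero] at this
    rw [← this]
    refine integral_congr_ae (Eventually.of_forall fun ξ => ?_)
    simp [← Complex.exp_conj]
  have hre := fm_fourier_inj (μ := μ) (h := fun ξ => (g ξ).re) hg.re fun ω => by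
    have e : ∀ ξ, ((g ξ).re : ℂ) * Complex.exp (ω * ξ * Complex.I) =
      (1/2 : ℂ) * (g ξ * Complex.exp (ω * ξ * Complex.I) + (starRingEnd ℂ) (g ξ) * Complex.exp (ω * ξ * Complex.I)) := by
      intro ξ; rw [Complex.re_eq_add_conj]; ring
    simp_rw [e]
    rw [integral_const_mul, integral_add (hb _ ω hg) (hb _ ω hgc), h0, h1]; simp
  have him := fm_fourier_inj (μ := μ) (h := fun ξ => (g ξ).im) hg.im fun ω => by
    have e : ∀ ξ, ((g ξ).im : ℂ) * Complex.exp (ω * ξ * Complex.I) =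
      (1/(2 * Complex.I) : ℂ) * (g ξ * Complex.exp (ω * ξ * Complex.I) - (starRingEnd ℂ) (g ξ) * Complex.exp (ω * ξ * Complex.I)) := by
      intro ξ; rw [Complex.im_eq_sub_conj]; ring
    simp_rw [e]
    rw [integral_const_mul, integral_sub (hb _ ω hg) (hb _ ω hgc), h0, h1]; simp
  filter_upwards [hre, him] with ξ a b
  exact Complex.ext a b

lemma fm_decay_int : IntegrableOn (fun t : ℝ => (1 + t)⁻¹ * (Real.sqrt t)⁻¹) (Ioi 0) := by
  have hm : Measurable (fun t : ℝ => (1 + t)⁻¹ * (Real.sqrt t)⁻¹) := by fun_prop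
  have hsq : ∀ t : ℝ, 0 < t → (Real.sqrt t)⁻¹ = t ^ (-(1/2) : ℝ) := by
    intro t ht
    rw [Real.sqrt_eq_rpow, Real.rpow_neg ht.le]
  rw [← Ioc_union_Ioi_eq_Ioi (zero_le_one' ℝ)]
  refine IntegrableOn.union ?_ ?_
  · have : IntegrableOn (fun t : ℝ => t ^ (-(1/2) : ℝ)) (Ioc 0 1) := by
      rw [← intervalIntegrable_iff_integrableOn_Ioc_of_le zero_le_one]
      exact intervalIntegral.intervalIntegrable_rpow' (by norm_num)
    refine Integrable.mono' this hm.aestronglyMeasurable ?_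
    filter_upwards [ae_restrict_mem measurableSet_Ioc] with t ht
    have h0 : 0 < t := ht.1
    rw [Real.norm_of_nonneg (by positivity), ← hsq t h0]
    refine mul_le_of_le_one_left (by positivity) (inv_le_one_of_one_le₀ (by linarith))
  · have : IntegrableOn (fun t : ℝ => t ^ (-(3/2) : ℝ)) (Ioi 1) :=
      integrableOn_Ioi_rpow_of_lt (by norm_num) one_pos
    refine Integrable.mono' this hm.aestronglyMeasurable ?_
    filter_upwards [ae_restrict_mem measurableSet_Ioi] with t ht
    have h0 : 0 < t := lt_trans one_pos ht
    rw [Real.norm_of_nonneg (by positivity), hsq t h0,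
      show (-(3/2) : ℝ) = -1 + -(1/2) by norm_num, Real.rpow_add h0, Real.rpow_neg_one]
    gcongr
    linarith

noncomputable def fmf (ω ξ : ℝ) : ℂ := Complex.exp (-((1 + ω * Complex.I) * ξ))

lemma fmf_meas (ω : ℝ) : Measurable (fmf ω) := by unfold fmf; fun_prop

lemma fmf_norm (ω ξ : ℝ) : ‖fmf ω ξ‖ = Real.exp (-ξ) := by
  unfold fmf; rw [Complex.norm_exp]; simp

lemma fmf_int (ω : ℝ) : IntegrableOn (fmf ω) (Ioi 0) := by
  have := fun t => fmf_norm ω t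
  refine Integrable.mono' (integrableOn_exp_neg_Ioi 0) (fmf_meas ω).aestronglyMeasurable ?_
  filter_upwards with t
  rw [fmf_norm]

lemma fmf_int2 (ω : ℝ) : IntegrableOn (fun t => ‖fmf ω t‖ * (Real.sqrt t)⁻¹) (Ioi 0) := by
  have h := Real.GammaIntegral_convergent (s := 1/2) (by norm_num)
  refine h.congr_fun (fun t ht => ?_) measurableSet_Ioi
  have ht' : 0 < t := ht
  simp only
  rw [fmf_norm, Real.sqrt_eq_rpow, ← Real.rpow_neg ht'.le]; norm_num

lemma fmf_fourier (ω t : ℝ) : ∫ ξ : ℝ in Ioi 0, fmf ω ξ * Complex.exp (Complex.I * t * ξ) = 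
   (1 + (ω - t) * Complex.I)⁻¹ := by
  have := integral_exp_mul_complex_Ioi (a := -(1 + (ω - t) * Complex.I)) (by simp) 0
  simp only [fmf, ← Complex.exp_add]
  convert this using 1
  · congr 1; ext ξ; congr 1; ring
  · rw [Complex.ofReal_zero, mul_zero, Complex.exp_zero, neg_div_neg_eq, one_div]

lemma fmf_fourier_norm (ω : ℝ) {t : ℝ} (ht : 0 < t) : ‖(1 + (ω - t) * Complex.I : ℂ)⁻¹‖ ≤ (2 * (1 + |ω|)) * (1 + t)⁻¹ := by
  have h1 := Complex.abs_re_le_norm (1 + (ω - t) * Complex.I : ℂ)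
  have h2 := Complex.abs_im_le_norm (1 + (ω - t) * Complex.I : ℂ)
  simp at h1 h2
  have h3 : t ≤ |ω| + |ω - t| := by
    have := abs_sub_abs_le_abs_sub t ω
    rw [abs_of_pos ht, abs_sub_comm] at this
    linarith
  rw [norm_inv, ← div_eq_mul_inv, inv_eq_one_div, div_le_div_iff₀ (by linarith) (by linarith)]
  nlinarith [abs_nonneg ω]

lemma fmf_int3 (ω : ℝ) : IntegrableOn (fun t : ℝ => ‖∫ ξ : ℝ in Ioi 0, fmf ω ξ * Complex.exp (Complex.I * t * ξ)‖ * (Real.sqrt t)⁻¹) (Ioi 0) := by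
  simp_rw [fmf_fourier]
  refine Integrable.mono' (fm_decay_int.const_mul (2 * (1 + |ω|))) (Measurable.aestronglyMeasurable (by fun_prop)) ?_
  filter_upwards [ae_restrict_mem measurableSet_Ioi] with t ht
  rw [Real.norm_of_nonneg (by positivity), ← mul_assoc]
  gcongr
  exact fmf_fourier_norm ω ht

lemma fm_sqrt_cpow {ξ : ℝ} (hξ : 0 < ξ) (c : ℂ) :
    (Real.sqrt ξ : ℂ)⁻¹ * Complex.exp (c * Real.log ξ) = (ξ : ℂ) ^ (-(1/2) + c) := by
  have hξ' : (ξ : ℂ) ≠ 0 := by exact_mod_cast hξ.ne'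
  rw [Complex.cpow_add _ _ hξ', Complex.cpow_neg, Real.sqrt_eq_rpow, Complex.ofReal_cpow hξ.le,
    Complex.cpow_def_of_ne_zero hξ' c, ← Complex.ofReal_log hξ.le, mul_comm c]
  simp

lemma fm_int_cpow {g : ℝ → ℂ} {μ : ℝ} (hgm : AEStronglyMeasurable g m0)
    (hg : Integrable (fun t => ‖g t‖ * (Real.sqrt t)⁻¹) m0) :
    IntegrableOn (fun t : ℝ => g t * (t : ℂ) ^ (-(1/2) + Complex.I * μ)) (Ioi 0) := by
  refine Integrable.mono' hg (hgm.mul (fm_cpow_meas _).aestronglyMeasurable) ?_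
  filter_upwards [ae_restrict_mem measurableSet_Ioi] with t ht
  have ht' : 0 < t := ht
  rw [norm_mul, Complex.norm_cpow_eq_rpow_re_of_pos ht, Real.sqrt_eq_rpow, ← Real.rpow_neg ht'.le]
  simp

lemma fm_comp (f : ℝ → ℂ) (μ : ℝ) (hf : Integrable f m0)
    (hf2 : Integrable (fun ξ => ‖f ξ‖ * (Real.sqrt ξ)⁻¹) m0)
    (hgm : AEStronglyMeasurable (fun t : ℝ => ∫ ξ : ℝ in Ioi 0, f ξ * Complex.exp (Complex.I * t * ξ)) m0)
    (hg : Integrable (fun t : ℝ => ‖∫ ξ : ℝ in Ioi 0, f ξ * Complex.exp (Complex.I * t * ξ)‖ * (Real.sqrt t)⁻¹) m0) :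
    ∫ t : ℝ in Ioi 0, ((Real.sqrt (2 * Real.pi) : ℂ)⁻¹ * ∫ ξ : ℝ in Ioi 0, f ξ * Complex.exp (Complex.I * t * ξ)) *
        (Real.sqrt t : ℂ)⁻¹ * Complex.exp (Complex.I * μ * Real.log t)
      = Fpm μ * ∫ ξ : ℝ in Ioi 0, f ξ * (Real.sqrt ξ : ℂ)⁻¹ * Complex.exp (-(Complex.I * μ) * Real.log ξ) := by
  have hs1 : (1/2 + Complex.I * μ : ℂ) - 1 = -(1/2) + Complex.I * μ := by ring
  have hs2 : -(1/2 + Complex.I * μ : ℂ) = -(1/2) + Complex.I * ((-μ : ℝ) : ℂ) := by push_cast; ring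
  have key := fm_key f (1/2 + Complex.I * μ) (by simp) hf
    (by rw [hs2]; exact fm_int_cpow hf.1 hf2) (by rw [hs1]; exact fm_int_cpow hgm hg)
  rw [hs1, hs2] at key
  have e1 : ∫ t : ℝ in Ioi 0, ((Real.sqrt (2 * Real.pi) : ℂ)⁻¹ * ∫ ξ : ℝ in Ioi 0, f ξ * Complex.exp (Complex.I * t * ξ)) *
        (Real.sqrt t : ℂ)⁻¹ * Complex.exp (Complex.I * μ * Real.log t) = (Real.sqrt (2 * Real.pi) : ℂ)⁻¹ *
      ∫ t : ℝ in Ioi 0, (∫ ξ : ℝ in Ioi 0, f ξ * Complex.exp (Complex.I * t * ξ)) * (t : ℂ) ^ (-(1/2) + Complex.I * μ) := by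
    rw [← integral_const_mul]
    refine setIntegral_congr_fun measurableSet_Ioi fun t ht => ?_
    rw [← fm_sqrt_cpow ht]; ring
  have e2 : ∫ ξ : ℝ in Ioi 0, f ξ * (Real.sqrt ξ : ℂ)⁻¹ * Complex.exp (-(Complex.I * μ) * Real.log ξ) =
      ∫ ξ : ℝ in Ioi 0, f ξ * (ξ : ℂ) ^ (-(1/2) + Complex.I * ((-μ : ℝ) : ℂ)) := by
    refine setIntegral_congr_fun measurableSet_Ioi fun t ht => ?_
    rw [← fm_sqrt_cpow ht]; push_cast; ring_nf
  rw [e1, e2, key]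
  have e3 : Complex.exp (Complex.I * Real.pi * (1/2 + Complex.I * μ) / 2) =
      Complex.exp (Complex.I * Real.pi / 4) * Complex.exp (-(Real.pi * μ) / 2) := by
    rw [← Complex.exp_add]; congr 1
    linear_combination (Real.pi * μ / 2 : ℂ) * Complex.I_sq
  rw [e3]; unfold Fpm; ring

lemma fm_neg (μ : ℝ) : Fpm (-μ) = Fmp μ := by
  unfold Fpm Fmp; push_cast; ring_nf

lemma fmf_memLp (ω : ℝ) : MemLp (fmf ω) 2 m0 := by
  rw [memLp_two_iff_integrable_sq_norm (fmf_meas ω).aestronglyMeasurable]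
  have h : IntegrableOn (fun x : ℝ => Real.exp (-2 * x)) (Ioi 0) := exp_neg_integrableOn_Ioi 0 (by norm_num)
  refine h.congr (Eventually.of_forall fun x => ?_)
  simp only
  rw [fmf_norm, ← Real.exp_nat_mul]; congr 1; push_cast; ring

noncomputable def fmE (ω : ℝ) : Lp ℂ 2 m0 := (fmf_memLp ω).toLp _

lemma fmE_coe (ω : ℝ) : fmE ω =ᵐ[m0] fmf ω := (fmf_memLp ω).coeFn_toLp

lemma fmE_dense : (Submodule.span ℂ (range fmE)).topologicalClosure = ⊤ := by
  rw [Submodule.topologicalClosure_eq_top_iff, Submodule.eq_bot_iff]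
  intro y hy
  have h0 : ∀ ω : ℝ, ∫ ξ, (y ξ * fmf 0 ξ) * Complex.exp (ω * ξ * Complex.I) ∂m0 = 0 := by
    intro ω
    have := hy (fmE ω) (Submodule.subset_span ⟨ω, rfl⟩)
    rw [L2.inner_def] at this
    rw [← this]
    refine integral_congr_ae ?_
    filter_upwards [fmE_coe ω] with ξ hξ
    rw [hξ, RCLike.inner_apply]
    simp only [fmf, ← Complex.exp_conj]
    rw [mul_assoc, ← Complex.exp_add]
    congr 2
    simp
    ring
  have hi : Integrable (fun ξ => y ξ * fmf 0 ξ) m0 := (Lp.memLp y).integrable_mul (fmf_memLp 0)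
  have := fm_fourier_injC hi h0
  rw [Lp.eq_zero_iff_ae_eq_zero]
  filter_upwards [this] with ξ hξ
  simpa [fmf] using hξ


end FmHelpers

/-- If `T` is the truncated Fourier–Plancherel operator on `L²(ℝ⁺)` and `U`
is the surjective isometry onto `L²(ℝ⁺; ℂ²)` given by the pair of Mellin-type transforms, then
`U` intertwines `T` with multiplication by the matrix function `F`: for every `x ∈ L²(ℝ⁺)`,
`(U (T x))(μ) = F(μ) · (U x)(μ)` for a.e. `μ > 0`. -/
theorem functional_model
    (T : Lp ℂ 2 m0 →L[ℂ] Lp ℂ 2 m0)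
    (hT : ∀ x : Lp ℂ 2 m0, Integrable (⇑x) m0 →
      (⇑(T x) : ℝ → ℂ) =ᵐ[m0] fun t =>
        (Real.sqrt (2 * Real.pi) : ℂ)⁻¹ *
          ∫ ξ in Ioi (0:ℝ), x ξ * Complex.exp (Complex.I * t * ξ))
    (U : Lp ℂ 2 m0 ≃ₗᵢ[ℂ] Lp (EuclideanSpace ℂ (Fin 2)) 2 m0)
    (hU : ∀ x : Lp ℂ 2 m0, Integrable (fun ξ => ‖x ξ‖ * (Real.sqrt ξ)⁻¹) m0 →
      (⇑(U x) : ℝ → EuclideanSpace ℂ (Fin 2)) =ᵐ[m0] fun μ =>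
        (WithLp.equiv 2 (Fin 2 → ℂ)).symm
          ![(Real.sqrt (2 * Real.pi) : ℂ)⁻¹ *
              ∫ ξ in Ioi (0:ℝ), x ξ * (Real.sqrt ξ : ℂ)⁻¹ *
                Complex.exp (Complex.I * μ * Real.log ξ),
            (Real.sqrt (2 * Real.pi) : ℂ)⁻¹ *
              ∫ ξ in Ioi (0:ℝ), x ξ * (Real.sqrt ξ : ℂ)⁻¹ *
                Complex.exp (-(Complex.I * μ) * Real.log ξ)]) :
    ∀ x : Lp ℂ 2 m0,
      (⇑(U (T x)) : ℝ → EuclideanSpace ℂ (Fin 2)) =ᵐ[m0] fun μ =>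
        (WithLp.equiv 2 (Fin 2 → ℂ)).symm
          ((Fmat μ).mulVec (WithLp.equiv 2 (Fin 2 → ℂ) (U x μ))) := by
  have hbase : ∀ ω : ℝ, (⇑(U (T (fmE ω))) : ℝ → EuclideanSpace ℂ (Fin 2)) =ᵐ[m0] fun μ =>
        (WithLp.equiv 2 (Fin 2 → ℂ)).symm
          ((Fmat μ).mulVec (WithLp.equiv 2 (Fin 2 → ℂ) (U (fmE ω) μ))) := by
    intro ω
    have hE := fmE_coe ω
    have hEi : ∀ (k : ℝ → ℂ), ∫ ξ in Ioi (0:ℝ), fmE ω ξ * k ξ = ∫ ξ in Ioi (0:ℝ), fmf ω ξ * k ξ := by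
      intro k
      refine integral_congr_ae ?_
      have hE' : fmE ω =ᵐ[volume.restrict (Ioi 0)] fmf ω := hE
      filter_upwards [hE'] with ξ hξ
      rw [hξ]
    have hfi : Integrable (fmf ω) m0 := fmf_int ω
    have hfi2 : Integrable (fun t => ‖fmf ω t‖ * (Real.sqrt t)⁻¹) m0 := fmf_int2 ω
    have hfi3 : Integrable (fun t : ℝ => ‖∫ ξ : ℝ in Ioi 0, fmf ω ξ * Complex.exp (Complex.I * t * ξ)‖ * (Real.sqrt t)⁻¹) m0 := fmf_int3 ω
    have hTE := hT (fmE ω) (hfi.congr hE.symm)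
    simp_rw [hEi] at hTE
    have hUE := hU (fmE ω) (hfi2.congr (by filter_upwards [hE] with ξ hξ; rw [hξ]))
    have hUT := hU (T (fmE ω)) ((hfi3.const_mul ‖(Real.sqrt (2 * Real.pi) : ℂ)⁻¹‖).congr
      (by filter_upwards [hTE] with ξ hξ; rw [hξ, norm_mul]; ring))
    have hTi : ∀ (k : ℝ → ℂ), ∫ t in Ioi (0:ℝ), T (fmE ω) t * k t = ∫ t : ℝ in Ioi (0:ℝ), ((Real.sqrt (2 * Real.pi) : ℂ)⁻¹ *
          ∫ ξ in Ioi (0:ℝ), fmf ω ξ * Complex.exp (Complex.I * t * ξ)) * k t := by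
      intro k
      refine integral_congr_ae ?_
      have hE' : T (fmE ω) =ᵐ[volume.restrict (Ioi 0)] _ := hTE
      filter_upwards [hE'] with ξ hξ
      rw [hξ]
    have hgm : AEStronglyMeasurable (fun t : ℝ => ∫ ξ : ℝ in Ioi 0, fmf ω ξ * Complex.exp (Complex.I * t * ξ)) m0 := by
      simp_rw [fmf_fourier]
      exact Measurable.aestronglyMeasurable (by fun_prop)
    filter_upwards [hUE, hUT] with μ h1 h2
    rw [h1, h2]
    have c1 := fm_comp (fmf ω) μ hfi hfi2 hgm hfi3
    have c2 := fm_comp (fmf ω) (-μ) hfi hfi2 hgm hfi3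
    rw [fm_neg] at c2
    push_cast at c2
    simp only [mul_neg, neg_neg] at c2
    simp only [mul_assoc] at c1 c2 ⊢
    simp only [hEi, hTi]
    simp only [mul_assoc, neg_mul] at c1 c2 ⊢
    rw [c1, c2]
    congr 1
    ext i
    fin_cases i
    · simp [Fmat, Matrix.mulVec, dotProduct, Fin.sum_univ_two]; ring
    · simp [Fmat, Matrix.mulVec, dotProduct, Fin.sum_univ_two]; ring
  intro x
  have hx : x ∈ (Submodule.span ℂ (range fmE)).topologicalClosure := by
    rw [fmE_dense]; trivial
  have hspan : ∀ z ∈ Submodule.span ℂ (range fmE), (⇑(U (T z)) : ℝ → EuclideanSpace ℂ (Fin 2)) =ᵐ[m0] fun μ =>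
        (WithLp.equiv 2 (Fin 2 → ℂ)).symm
          ((Fmat μ).mulVec (WithLp.equiv 2 (Fin 2 → ℂ) (U z μ))) := by
    intro z hz
    induction hz using Submodule.span_induction with
    | mem z hz => obtain ⟨ω, rfl⟩ := hz; exact hbase ω
    | zero =>
      rw [map_zero, map_zero]
      filter_upwards [Lp.coeFn_zero (EuclideanSpace ℂ (Fin 2)) 2 m0] with μ h
      rw [h]
      ext i
      simp
    | add a b _ _ ha hb =>
      rw [map_add, map_add, map_add]
      filter_upwards [ha, hb, Lp.coeFn_add (U a) (U b), Lp.coeFn_add (U (T a)) (U (T b))] with μ h1 h2 h3 h4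
      rw [h3, h4, Pi.add_apply, Pi.add_apply, h1, h2]
      ext i
      fin_cases i <;> simp [Matrix.mulVec_add]
    | smul c a _ ha =>
      rw [map_smul, map_smul, map_smul]
      filter_upwards [ha, Lp.coeFn_smul c (U a), Lp.coeFn_smul c (U (T a))] with μ h1 h3 h4
      rw [h3, h4, Pi.smul_apply, Pi.smul_apply, h1]
      ext i
      fin_cases i <;> simp [Matrix.mulVec_smul]
  obtain ⟨z, hz, hzx⟩ := mem_closure_iff_seq_limit.1 hx
  have t1 : Filter.Tendsto (fun n => U (z n)) Filter.atTop (nhds (U x)) := (U.continuous.tendsto x).comp hzx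
  obtain ⟨ns, hns, hn⟩ := (tendstoInMeasure_of_tendsto_Lp t1).exists_seq_tendsto_ae
  have t2 : Filter.Tendsto (fun n => U (T (z (ns n)))) Filter.atTop (nhds (U (T x))) :=
    (((U.continuous.comp T.continuous).tendsto x).comp hzx).comp hns.tendsto_atTop
  obtain ⟨ms, hms, hm⟩ := (tendstoInMeasure_of_tendsto_Lp t2).exists_seq_tendsto_ae
  have hall := ae_all_iff.2 fun n => hspan (z n) (hz n)
  filter_upwards [hn, hm, hall] with μ h1 h2 h3
  have h4 := h1.comp hms.tendsto_atTop
  have hc : Continuous fun v : EuclideanSpace ℂ (Fin 2) => (WithLp.equiv 2 (Fin 2 → ℂ)).symm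
          ((Fmat μ).mulVec (WithLp.equiv 2 (Fin 2 → ℂ) v)) := by
    refine (PiLp.continuous_toLp 2 _).comp ?_
    exact Continuous.matrix_mulVec continuous_const (PiLp.continuous_ofLp 2 _)
  refine tendsto_nhds_unique h2 (((hc.tendsto _).comp h4).congr fun i => ?_)
  exact (h3 _).symm
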